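/- Let |Ψ⟩_ABC be a tripartite pure state with tensor rank equal to max{d_A, d_B}, where d_A, d_B are the local ranks of ρ_A, ρ_B. If ρ_AB satisfies the reduction criterion, then ρ_AB is separable. -/

import Mathlib

open Matrix BigOperators
open scoped ComplexOrder

noncomputable section

/-- A density matrix: positive semidefinite with trace one. -/
def IsDensity {α : Type*} [Fintype α] (ρ : Matrix α α ℂ) : Prop :=
  ρ.PosSemidef ∧ ρ.trace = 1

/-- Tensor (Kronecker) product of matrices on a product index type. -/
def tens {α β : Type*} (σ : Matrix α α ℂ) (τ : Matrix β β ℂ) :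
    Matrix (α × β) (α × β) ℂ :=
  fun p q => σ p.1 q.1 * τ p.2 q.2

/-- Separability: a finite convex combination of product density matrices. -/
def SeparableState {α β : Type*} [Fintype α] [Fintype β]
    (ρ : Matrix (α × β) (α × β) ℂ) : Prop :=
  ∃ (k : ℕ) (p : Fin k → ℝ) (σ : Fin k → Matrix α α ℂ) (τ : Fin k → Matrix β β ℂ),
    (∀ i, 0 ≤ p i) ∧ ∑ i, p i = 1 ∧ (∀ i, IsDensity (σ i)) ∧ (∀ i, IsDensity (τ i)) ∧
    ρ = ∑ i, (p i : ℂ) • tens (σ i) (τ i)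

/-- Partial transpose with respect to the second system. -/
def ptransB {α β : Type*} (ρ : Matrix (α × β) (α × β) ℂ) :
    Matrix (α × β) (α × β) ℂ :=
  fun p q => ρ (p.1, q.2) (q.1, p.2)

/-- Partial trace over the second system. -/
def ptrB {α β : Type*} [Fintype β] (ρ : Matrix (α × β) (α × β) ℂ) : Matrix α α ℂ :=
  fun i k => ∑ j, ρ (i, j) (k, j)

/-- Partial trace over the first system. -/
def ptrA {α β : Type*} [Fintype α] (ρ : Matrix (α × β) (α × β) ℂ) : Matrix β β ℂ :=
  fun j l => ∑ i, ρ (i, j) (i, l)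

/-- Rank-one projection |ψ⟩⟨ψ| associated with a vector. -/
def projv {α : Type*} (ψ : α → ℂ) : Matrix α α ℂ :=
  fun x y => ψ x * (starRingEnd ℂ) (ψ y)

/-- Unit vector condition. -/
def UnitVec {α : Type*} [Fintype α] (ψ : α → ℂ) : Prop :=
  ∑ x, Complex.normSq (ψ x) = 1

/-- Two-party reduced state ρ_АБ of a tripartite pure state. -/
def rhoAB {α β γ : Type*} [Fintype γ] (ψ : α × β × γ → ℂ) :
    Matrix (α × β) (α × β) ℂ :=
  fun p q => ∑ c, ψ (p.1, p.2, c) * (starRingEnd ℂ) (ψ (q.1, q.2, c))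

def rhoBC {α β γ : Type*} [Fintype α] (ψ : α × β × γ → ℂ) :
    Matrix (β × γ) (β × γ) ℂ :=
  fun p q => ∑ a, ψ (a, p.1, p.2) * (starRingEnd ℂ) (ψ (a, q.1, q.2))

def rhoAC {α β γ : Type*} [Fintype β] (ψ : α × β × γ → ℂ) :
    Matrix (α × γ) (α × γ) ℂ :=
  fun p q => ∑ b, ψ (p.1, b, p.2) * (starRingEnd ℂ) (ψ (q.1, b, q.2))

def rhoA {α β γ : Type*} [Fintype β] [Fintype γ] (ψ : α × β × γ → ℂ) :
    Matrix α α ℂ :=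
  fun x y => ∑ b, ∑ c, ψ (x, b, c) * (starRingEnd ℂ) (ψ (y, b, c))

def rhoB {α β γ : Type*} [Fintype α] [Fintype γ] (ψ : α × β × γ → ℂ) :
    Matrix β β ℂ :=
  fun x y => ∑ a, ∑ c, ψ (a, x, c) * (starRingEnd ℂ) (ψ (a, y, c))

def rhoC {α β γ : Type*} [Fintype α] [Fintype β] (ψ : α × β × γ → ℂ) :
    Matrix γ γ ℂ :=
  fun x y => ∑ a, ∑ b, ψ (a, b, x) * (starRingEnd ℂ) (ψ (a, b, y))

/-- `x` majorizes `y` (for nonnegative vectors, with implicit zero padding):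
the sum of any `|T|` entries of `y` is dominated by some choice of at most
`|T|` entries of `x`, and the total sums agree. -/
def Majorizes {α β : Type*} [Fintype α] [Fintype β] (x : α → ℝ) (y : β → ℝ) : Prop :=
  (∀ T : Finset β, ∃ S : Finset α, S.card ≤ T.card ∧ ∑ i ∈ T, y i ≤ ∑ i ∈ S, x i) ∧
  ∑ i, x i = ∑ i, y i

/-- Von Neumann entropy of a Hermitian matrix, via its eigenvalues. -/
def vN {α : Type*} [Fintype α] [DecidableEq α] {ρ : Matrix α α ℂ}
    (h : ρ.IsHermitian) : ℝ :=
  -∑ i, h.eigenvalues i * Real.log (h.eigenvalues i)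

/-- Tensor rank of a tripartite vector: least number of product vectors summing to it. -/
def tensorRank {α β γ : Type*} [Fintype α] [Fintype β] [Fintype γ]
    (ψ : α × β × γ → ℂ) : ℕ :=
  sInf {r : ℕ | ∃ (a : Fin r → α → ℂ) (b : Fin r → β → ℂ) (c : Fin r → γ → ℂ),
    ∀ x, ψ x = ∑ i, a i x.1 * b i x.2.1 * c i x.2.2}

/-- Orthonormal family of vectors. -/
def OrthonormalFam {α : Type*} [Fintype α] {k : ℕ} (v : Fin k → α → ℂ) : Prop :=
  ∀ i j, ∑ x, (starRingEnd ℂ) (v i x) * v j x = if i = j then 1 else 0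

/-- Maximally correlated state: ρ = Σ_{i,j} c_{ij} |i_B⟩⟨j_B| ⊗ |i_C⟩⟨j_C|
for some orthonormal families. -/
def IsMaxCorrelated {β γ : Type*} [Fintype β] [Fintype γ]
    (ρ : Matrix (β × γ) (β × γ) ℂ) : Prop :=
  ∃ (k : ℕ) (c : Matrix (Fin k) (Fin k) ℂ) (e : Fin k → β → ℂ) (f : Fin k → γ → ℂ),
    OrthonormalFam e ∧ OrthonormalFam f ∧
    ∀ p q, ρ p q = ∑ i, ∑ j,
      c i j * (e i p.1 * (starRingEnd ℂ) (e j q.1)) * (f i p.2 * (starRingEnd ℂ) (f j q.2))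

lemma Matrix.PosSemidef.exists_density {α : Type*} [Fintype α] [Nonempty α]
    {σ : Matrix α α ℂ} (h : σ.PosSemidef) :
    ∃ σ', IsDensity σ' ∧ σ = (σ.trace.re : ℂ) • σ' := by
  classical
  have hre : (σ.trace.re : ℂ) = σ.trace :=
    (Complex.eq_re_of_ofReal_le (r := 0) (by simpa using h.trace_nonneg)).symm
  rw [hre]
  by_cases h0 : σ.trace = 0
  · refine ⟨(Fintype.card α : ℂ)⁻¹ • 1, ⟨Matrix.PosSemidef.one.smul ?_, ?_⟩, ?_⟩
    · positivity
    · simp [Matrix.trace_smul]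
    · rw [h.trace_eq_zero_iff.1 h0]; simp
  · refine ⟨σ.trace⁻¹ • σ, ⟨h.smul (inv_nonneg.2 h.trace_nonneg), ?_⟩, ?_⟩
    · simp [Matrix.trace_smul, h0]
    · simp [smul_smul, h0]

lemma trace_tens {α β : Type*} [Fintype α] [Fintype β] (σ : Matrix α α ℂ) (τ : Matrix β β ℂ) :
    (tens σ τ).trace = σ.trace * τ.trace :=
  Matrix.trace_kronecker σ τ

lemma separableState_of_eq_sum {α β ι : Type*} [Fintype α] [Fintype β] [Fintype ι]
    {ρ : Matrix (α × β) (α × β) ℂ} (hρ : ρ.trace = 1)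
    (σ : ι → Matrix α α ℂ) (τ : ι → Matrix β β ℂ)
    (hσ : ∀ i, (σ i).PosSemidef) (hτ : ∀ i, (τ i).PosSemidef)
    (h : ρ = ∑ i, tens (σ i) (τ i)) : SeparableState ρ := by
  have hne : Nonempty (α × β) := by
    by_contra hc
    rw [not_nonempty_iff] at hc
    simp [Matrix.trace] at hρ
  have : Nonempty α := hne.map Prod.fst
  have : Nonempty β := hne.map Prod.snd
  choose σ' hσ' hσe using fun i => (hσ i).exists_density
  choose τ' hτ' hτe using fun i => (hτ i).exists_density
  let e := Fintype.equivFin ι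
  have key : ρ = ∑ i, (((σ i).trace.re * (τ i).trace.re : ℝ) : ℂ) • tens (σ' i) (τ' i) := by
    rw [h]
    refine Finset.sum_congr rfl fun i _ => ?_
    conv_lhs => rw [hσe i, hτe i]
    ext p q
    simp only [tens, Matrix.smul_apply, smul_eq_mul]
    push_cast
    ring
  refine ⟨Fintype.card ι, fun i => (σ (e.symm i)).trace.re * (τ (e.symm i)).trace.re,
    fun i => σ' (e.symm i), fun i => τ' (e.symm i), fun i => ?_, ?_, fun i => hσ' _,
    fun i => hτ' _, ?_⟩
  · exact mul_nonneg (Complex.le_def.1 (hσ _).trace_nonneg).1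
      (Complex.le_def.1 (hτ _).trace_nonneg).1
  · rw [e.symm.sum_comp fun i => (σ i).trace.re * (τ i).trace.re]
    have := congrArg Matrix.trace key
    rw [hρ, Matrix.trace_sum] at this
    simp only [Matrix.trace_smul, trace_tens, (hσ' _).2, (hτ' _).2, smul_eq_mul, mul_one] at this
    exact_mod_cast this.symm
  · rw [key]
    exact (e.symm.sum_comp fun i =>
      (((σ i).trace.re * (τ i).trace.re : ℝ) : ℂ) • tens (σ' i) (τ' i)).symm

lemma SeparableState.swap {α β : Type*} [Fintype α] [Fintype β]
    {ρ : Matrix (α × β) (α × β) ℂ} (h : SeparableState ρ) :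
    SeparableState (ρ.submatrix Prod.swap Prod.swap) := by
  obtain ⟨k, p, σ, τ, hp, hp1, hσ, hτ, rfl⟩ := h
  refine ⟨k, p, τ, σ, hp, hp1, hτ, hσ, ?_⟩
  ext x y
  simp [Matrix.sum_apply, tens, mul_comm]

lemma Matrix.exists_left_inverse_of_rank {α : Type*} [Fintype α] {r : ℕ}
    (A : Matrix α (Fin r) ℂ) (h : r ≤ A.rank) : ∃ W : Matrix (Fin r) α ℂ, W * A = 1 := by
  classical
  have hs : Function.Surjective Aᴴ.mulVec := by
    have : Aᴴ.mulVecLin.range = ⊤ := by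
      apply Submodule.eq_top_of_finrank_eq
      rw [← Matrix.rank, Matrix.rank_conjTranspose]
      exact le_antisymm (by simpa using A.rank_le_card_width) (by simpa using h)
    exact LinearMap.range_eq_top.1 this
  obtain ⟨B, hB⟩ := Matrix.mulVec_surjective_iff_exists_right_inverse.1 hs
  refine ⟨Bᴴ, ?_⟩
  simpa using congrArg Matrix.conjTranspose hB

/-- The reduction inequality is preserved by a local operator on the first system. -/
lemma reduction_local {α β γ δ : Type*} [Fintype α] [Fintype β] [DecidableEq β] [Fintype γ]
    [Fintype δ] (ψ : α × β × γ → ℂ)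
    (hred : (tens (rhoA ψ) (1 : Matrix β β ℂ) - rhoAB ψ).PosSemidef)
    (W : Matrix δ α ℂ) (φ : δ × β × γ → ℂ)
    (hφ : ∀ j y z, φ (j, y, z) = ∑ x, W j x * ψ (x, y, z)) :
    (tens (rhoA φ) (1 : Matrix β β ℂ) - rhoAB φ).PosSemidef := by
  let S : Matrix (δ × β) (α × β) ℂ := Matrix.kroneckerMap (· * ·) W 1
  let Ψ : Matrix α (β × γ) ℂ := Matrix.of fun x q => ψ (x, q)
  let Φ : Matrix δ (β × γ) ℂ := Matrix.of fun x q => φ (x, q)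
  let Ψ' : Matrix (α × β) γ ℂ := Matrix.of fun p z => ψ (p.1, p.2, z)
  let Φ' : Matrix (δ × β) γ ℂ := Matrix.of fun p z => φ (p.1, p.2, z)
  have h1 : rhoA ψ = Ψ * Ψᴴ := by
    ext x y; simp [rhoA, Ψ, Matrix.mul_apply, Fintype.sum_prod_type]
  have h2 : rhoA φ = Φ * Φᴴ := by
    ext x y; simp [rhoA, Φ, Matrix.mul_apply, Fintype.sum_prod_type]
  have h3 : rhoAB ψ = Ψ' * Ψ'ᴴ := by
    ext x y; simp [rhoAB, Ψ', Matrix.mul_apply]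
  have h4 : rhoAB φ = Φ' * Φ'ᴴ := by
    ext x y; simp [rhoAB, Φ', Matrix.mul_apply]
  have h5 : Φ = W * Ψ := by
    ext x y; simp [Φ, Ψ, Matrix.mul_apply, hφ]
  have h6 : Φ' = S * Ψ' := by
    ext x y
    simp [Φ', Ψ', S, Matrix.mul_apply, hφ, Fintype.sum_prod_type, Matrix.kroneckerMap_apply,
      Matrix.one_apply]
  have h7 : tens (rhoA φ) (1 : Matrix β β ℂ) = S * tens (rhoA ψ) (1 : Matrix β β ℂ) * Sᴴ := by
    change Matrix.kroneckerMap (· * ·) (rhoA φ) (1 : Matrix β β ℂ) =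
      S * Matrix.kroneckerMap (· * ·) (rhoA ψ) (1 : Matrix β β ℂ) * Sᴴ
    rw [Matrix.conjTranspose_kronecker, ← Matrix.mul_kronecker_mul, ← Matrix.mul_kronecker_mul,
      h2, h1, h5]
    simp [Matrix.mul_assoc]
  have := hred.mul_mul_conjTranspose_same S
  rwa [Matrix.mul_sub, Matrix.sub_mul, ← h7, h3,
    show S * (Ψ' * Ψ'ᴴ) * Sᴴ = rhoAB φ by simp [h4, h6, Matrix.mul_assoc]] at this

/-- For a vector `∑ i, |i⟩|b i⟩|c i⟩` satisfying the reduction inequality, `b i` and `b j` are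
proportional unless `c i` and `c j` are orthogonal. -/
lemma reduction_orthonormal {β γ : Type*} [Fintype β] [DecidableEq β] [Fintype γ] {r : ℕ}
    (b : Fin r → β → ℂ) (c : Fin r → γ → ℂ) (φ : Fin r × β × γ → ℂ)
    (hφ : ∀ j y z, φ (j, y, z) = b j y * c j z)
    (hred : (tens (rhoA φ) (1 : Matrix β β ℂ) - rhoAB φ).PosSemidef) (i j : Fin r) :
    (c j ⬝ᵥ star (c i)) • ((b j ⬝ᵥ star (b i)) • b i) =
      (c j ⬝ᵥ star (c i)) • ((b i ⬝ᵥ star (b i)) • b j) := by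
  set M := tens (rhoA φ) (1 : Matrix β β ℂ) - rhoAB φ with hM
  let v : Fin r × β → ℂ := fun p => if p.1 = i then b i p.2 else 0
  have hMv : ∀ k y, (M *ᵥ v) (k, y) = (c k ⬝ᵥ star (c i)) *
      ((b k ⬝ᵥ star (b i)) * b i y - (b i ⬝ᵥ star (b i)) * b k y) := by
    intro k y
    have hA : rhoA φ k i = (b k ⬝ᵥ star (b i)) * (c k ⬝ᵥ star (c i)) := by
      simp only [rhoA, hφ, dotProduct, Finset.sum_mul_sum, Pi.star_apply, map_mul]
      refine Finset.sum_congr rfl fun _ _ => Finset.sum_congr rfl fun _ _ => ?_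
      simp only [starRingEnd_apply]; ring
    have hAB : ∀ y', rhoAB φ (k, y) (i, y') = (b k y * star (b i y')) * (c k ⬝ᵥ star (c i)) := by
      intro y'
      simp only [rhoAB, hφ, dotProduct, Finset.mul_sum, Pi.star_apply, map_mul]
      refine Finset.sum_congr rfl fun _ _ => ?_
      simp only [starRingEnd_apply]; ring
    have h1 : (M *ᵥ v) (k, y) = ∑ y', M (k, y) (i, y') * b i y' := by
      simp only [Matrix.mulVec, dotProduct, Fintype.sum_prod_type, v, mul_ite, mul_zero]
      rw [Finset.sum_comm]
      simp
    rw [h1]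
    simp only [hM, Matrix.sub_apply, tens, hA, hAB, sub_mul, Finset.sum_sub_distrib,
      Matrix.one_apply]
    simp only [mul_ite, mul_one, mul_zero, ite_mul, zero_mul, Finset.sum_ite_eq,
      Finset.mem_univ, if_true]
    have h2 : ∑ y', b k y * star (b i y') * (c k ⬝ᵥ star (c i)) * b i y' =
        b k y * (c k ⬝ᵥ star (c i)) * (b i ⬝ᵥ star (b i)) := by
      rw [dotProduct.eq_1 (b i), Finset.mul_sum]
      refine Finset.sum_congr rfl fun _ _ => ?_
      simp only [Pi.star_apply]; ring
    rw [h2]; ring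
  have h0 : M *ᵥ v = 0 := by
    refine (hred.dotProduct_mulVec_zero_iff v).1 ?_
    simp only [dotProduct, Fintype.sum_prod_type]
    refine Finset.sum_eq_zero fun k _ => Finset.sum_eq_zero fun y _ => ?_
    by_cases hk : k = i
    · subst hk; rw [hMv]; simp
    · simp [v, hk]
  ext y
  have := (hMv j y).symm.trans (congrFun h0 (j, y))
  simp only [Pi.smul_apply, smul_eq_mul]
  simp only [Pi.zero_apply, mul_sub] at this
  exact sub_eq_zero.1 this

/-- Equality up to a nonzero scalar. -/
def proportionalSetoid {β : Type*} {r : ℕ} (b : Fin r → β → ℂ) : Setoid (Fin r) where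
  r i j := ∃ l : ℂ, l ≠ 0 ∧ b i = l • b j
  iseqv := {
    refl := fun i => ⟨1, one_ne_zero, by simp⟩
    symm := by
      rintro i j ⟨l, hl, h⟩
      exact ⟨l⁻¹, inv_ne_zero hl, by simp [h, smul_smul, hl]⟩
    trans := by
      rintro i j k ⟨l, hl, h⟩ ⟨m, hm, h'⟩
      exact ⟨l * m, mul_ne_zero hl hm, by rw [h, h', smul_smul]⟩ }

lemma trace_rhoAB {α β γ : Type*} [Fintype α] [Fintype β] [Fintype γ]
    {ψ : α × β × γ → ℂ} (hψ : UnitVec ψ) : (rhoAB ψ).trace = 1 := by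
  simp only [Matrix.trace, Matrix.diag, rhoAB, Complex.mul_conj, Fintype.sum_prod_type]
  simp only [UnitVec, Fintype.sum_prod_type] at hψ
  exact_mod_cast hψ

lemma separable_of_orthogonal_classes {α β γ : Type*} [Fintype α] [Fintype β] [Fintype γ] {r : ℕ}
    (ψ : α × β × γ → ℂ) (hψ : UnitVec ψ)
    (a : Fin r → α → ℂ) (b : Fin r → β → ℂ) (c : Fin r → γ → ℂ)
    (hdec : ∀ x, ψ x = ∑ i, a i x.1 * b i x.2.1 * c i x.2.2)
    (hpar : ∀ i j, (c j ⬝ᵥ star (c i)) • ((b j ⬝ᵥ star (b i)) • b i) =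
      (c j ⬝ᵥ star (c i)) • ((b i ⬝ᵥ star (b i)) • b j)) :
    SeparableState (rhoAB ψ) := by
  classical
  let f : Fin r → Fin r := fun i => (Quotient.mk (proportionalSetoid b) i).out
  have hf : ∀ i, ∃ l : ℂ, b i = l • b (f i) := fun i => by
    obtain ⟨l, -, h⟩ := (proportionalSetoid b).symm (Quotient.mk_out (s := proportionalSetoid b) i)
    exact ⟨l, h⟩
  have hff : ∀ i j, (∃ l : ℂ, l ≠ 0 ∧ b i = l • b j) → f i = f j := fun i j h => by
    simp only [f]
    rw [Quotient.sound (s := proportionalSetoid b) h]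
  have horth : ∀ i j, f i ≠ f j → ∀ y y', b i y * star (b j y') * (c i ⬝ᵥ star (c j)) = 0 := by
    intro i j hij y y'
    by_contra hne
    have hi : b i y ≠ 0 := fun h => hne (by simp [h])
    have hj : b j y' ≠ 0 := fun h => hne (by simp [h])
    have hc : c i ⬝ᵥ star (c j) ≠ 0 := fun h => hne (by simp [h])
    have hbj : b j ⬝ᵥ star (b j) ≠ 0 := fun h =>
      hj (congrFun (dotProduct_self_star_eq_zero.1 h) y')
    have h := smul_right_injective _ hc (hpar j i)
    refine hij (hff i j ⟨(b j ⬝ᵥ star (b j))⁻¹ * (b i ⬝ᵥ star (b j)), ?_, ?_⟩)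
    · refine mul_ne_zero (inv_ne_zero hbj) fun h0 => ?_
      simp only [h0, zero_smul] at h
      exact mul_ne_zero hbj hi (congrFun h y).symm
    · rw [← smul_smul, h, smul_smul, inv_mul_cancel₀ hbj, one_smul]
  choose l hl using hf
  let u : Fin r × γ → α → ℂ := fun k x => ∑ i, if f i = k.1 then c i k.2 * l i * a i x else 0
  refine separableState_of_eq_sum (trace_rhoAB hψ)
    (fun k => Matrix.vecMulVec (u k) (star (u k)))
    (fun k => Matrix.vecMulVec (b k.1) (star (b k.1)))
    (fun k => Matrix.posSemidef_vecMulVec_self_star _)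
    (fun k => Matrix.posSemidef_vecMulVec_self_star _) ?_
  ext ⟨x, y⟩ ⟨x', y'⟩
  let t : Fin r → γ → α → β → ℂ := fun i z x y => a i x * b i y * c i z
  have hub : ∀ k z x y, u (k, z) x * b k y = ∑ i, if f i = k then t i z x y else 0 := by
    intro k z x y
    simp only [u, Finset.sum_mul]
    refine Finset.sum_congr rfl fun i _ => ?_
    split_ifs with h
    · simp only [t]
      rw [congrFun (hl i) y, h]
      simp only [Pi.smul_apply, smul_eq_mul]; ring
    · simp
  have hR : ∀ k z, tens (Matrix.vecMulVec (u (k, z)) (star (u (k, z))))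
      (Matrix.vecMulVec (b k) (star (b k))) (x, y) (x', y') =
      ∑ i, ∑ j, if f i = k ∧ f j = k then t i z x y * star (t j z x' y') else 0 := by
    intro k z
    have : tens (Matrix.vecMulVec (u (k, z)) (star (u (k, z))))
      (Matrix.vecMulVec (b k) (star (b k))) (x, y) (x', y') =
      (u (k, z) x * b k y) * star (u (k, z) x' * b k y') := by
      simp only [tens, Matrix.vecMulVec_apply, Pi.star_apply, star_mul']; ring
    rw [this, hub, hub, star_sum, Finset.sum_mul_sum]
    refine Finset.sum_congr rfl fun i _ => Finset.sum_congr rfl fun j _ => ?_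
    by_cases h1 : f i = k <;> by_cases h2 : f j = k <;> simp [h1, h2]
  have hL : rhoAB ψ (x, y) (x', y') = ∑ i, ∑ j, ∑ z, t i z x y * star (t j z x' y') := by
    simp only [rhoAB, hdec, map_sum, Finset.sum_mul_sum, starRingEnd_apply, t]
    rw [Finset.sum_comm]
    exact Finset.sum_congr rfl fun i _ => Finset.sum_comm
  rw [hL, Matrix.sum_apply, Fintype.sum_prod_type]
  simp only [hR]
  have hcomm : ∑ k, ∑ z, ∑ i, ∑ j,
      (if f i = k ∧ f j = k then t i z x y * star (t j z x' y') else 0) =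
      ∑ i, ∑ j, ∑ z, ∑ k,
      (if f i = k ∧ f j = k then t i z x y * star (t j z x' y') else 0) := by
    rw [Finset.sum_comm]
    simp_rw [Finset.sum_comm (s := (Finset.univ : Finset (Fin r))) (t := (Finset.univ : Finset γ))]
    refine Finset.sum_congr rfl fun z _ => ?_
    rw [Finset.sum_comm]
    exact Finset.sum_congr rfl fun i _ => Finset.sum_comm
  rw [hcomm]
  refine Finset.sum_congr rfl fun i _ => Finset.sum_congr rfl fun j _ => ?_
  by_cases hij : f i = f j
  · refine Finset.sum_congr rfl fun z _ => ?_
    simp [hij]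
  · have h1 : ∀ k, ¬ (f i = k ∧ f j = k) := fun k h => hij (h.1.trans h.2.symm)
    simp only [h1, if_false, Finset.sum_const_zero]
    have : ∑ z, t i z x y * star (t j z x' y') =
        a i x * star (a j x') * (b i y * star (b j y') * (c i ⬝ᵥ star (c j))) := by
      simp only [dotProduct, Finset.mul_sum, t, star_mul', Pi.star_apply]
      exact Finset.sum_congr rfl fun z _ => by ring
    rw [this, horth i j hij, mul_zero]

lemma separable_of_reduction_of_rank_le {α β γ : Type*} [Fintype α] [Fintype β] [DecidableEq β]
    [Fintype γ] {r : ℕ} (ψ : α × β × γ → ℂ) (hψ : UnitVec ψ)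
    (a : Fin r → α → ℂ) (b : Fin r → β → ℂ) (c : Fin r → γ → ℂ)
    (hdec : ∀ x, ψ x = ∑ i, a i x.1 * b i x.2.1 * c i x.2.2)
    (hr : r ≤ (rhoA ψ).rank)
    (hred : (tens (rhoA ψ) (1 : Matrix β β ℂ) - rhoAB ψ).PosSemidef) :
    SeparableState (rhoAB ψ) := by
  let A : Matrix α (Fin r) ℂ := Matrix.of fun x i => a i x
  let N : Matrix (Fin r) α ℂ := Matrix.of fun i x' =>
    ∑ y, ∑ z, b i y * c i z * (starRingEnd ℂ) (ψ (x', y, z))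
  have hA : rhoA ψ = A * N := by
    ext x x'
    simp only [rhoA, Matrix.mul_apply, A, N, Matrix.of_apply, Finset.mul_sum]
    conv_rhs => rw [Finset.sum_comm]
    refine Finset.sum_congr rfl fun y _ => ?_
    conv_rhs => rw [Finset.sum_comm]
    refine Finset.sum_congr rfl fun z _ => ?_
    rw [hdec (x, y, z), Finset.sum_mul]
    exact Finset.sum_congr rfl fun i _ => by ring
  obtain ⟨W, hW⟩ := A.exists_left_inverse_of_rank
    (hr.trans (by rw [hA]; exact Matrix.rank_mul_le_left _ _))
  have hW' : ∀ j i, ∑ x, W j x * a i x = if j = i then 1 else 0 := fun j i => by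
    rw [← Matrix.one_apply, ← hW]; rfl
  refine separable_of_orthogonal_classes ψ hψ a b c hdec
    (reduction_orthonormal b c (fun p => b p.1 p.2.1 * c p.1 p.2.2) (fun _ _ _ => rfl)
      (reduction_local ψ hred W _ fun j y z => ?_))
  simp only [hdec, Finset.mul_sum]
  rw [Finset.sum_comm]
  have : ∀ i, ∑ x, W j x * (a i x * b i y * c i z) = (if j = i then 1 else 0) * (b i y * c i z) := by
    intro i
    rw [← hW', Finset.sum_mul]
    exact Finset.sum_congr rfl fun x _ => by ring
  simp [this]

/-- Lemma 4 of the paper: if the tensor rank of |Ψ⟩ equals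
max{d_A, d_B}, then the reduction criterion for ρ_AB implies separability. -/
theorem separable_of_reduction_of_low_tensor_rank {a b c : ℕ}
    (ψ : Fin a × Fin b × Fin c → ℂ) (hψ : UnitVec ψ)
    (hrk : tensorRank ψ = max (rhoA ψ).rank (rhoB ψ).rank)
    (hred : (tens (rhoA ψ) (1 : Matrix (Fin b) (Fin b) ℂ) - rhoAB ψ).PosSemidef ∧
            (tens (1 : Matrix (Fin a) (Fin a) ℂ) (rhoB ψ) - rhoAB ψ).PosSemidef) :
    SeparableState (rhoAB ψ) := by
  have hmem : ∃ (u : Fin (tensorRank ψ) → Fin a → ℂ) (v : Fin (tensorRank ψ) → Fin b → ℂ)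
      (w : Fin (tensorRank ψ) → Fin c → ℂ),
      ∀ x, ψ x = ∑ i, u i x.1 * v i x.2.1 * w i x.2.2 := by
    refine Nat.sInf_mem (s := {r : ℕ | ∃ (u : Fin r → Fin a → ℂ) (v : Fin r → Fin b → ℂ)
      (w : Fin r → Fin c → ℂ), ∀ x, ψ x = ∑ i, u i x.1 * v i x.2.1 * w i x.2.2}) ?_
    let e := Fintype.equivFin (Fin a × Fin b × Fin c)
    refine ⟨_, fun i x => if x = (e.symm i).1 then ψ (e.symm i) else 0,
      fun i y => if y = (e.symm i).2.1 then 1 else 0,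
      fun i z => if z = (e.symm i).2.2 then 1 else 0, fun x => ?_⟩
    rw [e.symm.sum_comp fun p => (if x.1 = p.1 then ψ p else 0) *
      (if x.2.1 = p.2.1 then 1 else 0) * (if x.2.2 = p.2.2 then 1 else 0),
      Finset.sum_eq_single x]
    · simp
    · rintro ⟨p, q, s⟩ - hne
      by_contra h
      simp only [mul_ite, mul_one, mul_zero] at h
      split_ifs at h with h1 h2 h3 <;> simp_all
      exact hne (Prod.ext h3.symm (Prod.ext h2.symm h1.symm))
    · simp
  obtain ⟨u, v, w, hdec⟩ := hmem
  rcases le_total (rhoB ψ).rank (rhoA ψ).rank with h | h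
  · rw [max_eq_left h] at hrk
    exact separable_of_reduction_of_rank_le ψ hψ u v w hdec hrk.le hred.1
  · rw [max_eq_right h] at hrk
    let φ : Fin b × Fin a × Fin c → ℂ := fun p => ψ (p.2.1, p.1, p.2.2)
    have hφ : UnitVec φ := by
      simp only [UnitVec, Fintype.sum_prod_type, φ] at hψ ⊢
      rw [Finset.sum_comm]; exact hψ
    have hAB : rhoAB φ = (rhoAB ψ).submatrix Prod.swap Prod.swap := rfl
    have hsep : SeparableState (rhoAB φ) := by
      refine separable_of_reduction_of_rank_le φ hφ v u w (fun x => ?_) hrk.le ?_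
      · simp only [φ, hdec]
        exact Finset.sum_congr rfl fun i _ => by ring
      · have ht : tens (rhoA φ) (1 : Matrix (Fin a) (Fin a) ℂ) =
            (tens (1 : Matrix (Fin a) (Fin a) ℂ) (rhoB ψ)).submatrix Prod.swap Prod.swap := by
          ext p q
          exact mul_comm _ _
        rw [ht, hAB]
        exact hred.2.submatrix Prod.swap
    exact hsep.swap

end
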